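/- arXiv:1412.3936 — 3 statements merged into one kernel-verified Lean document; each statement's English description precedes it below -/
import Mathlib

section
/- With the setup below, if n is a positive integer with λ^(3n/2) > 2·(1 + √2)·C₁, then (C₂/2)·λ^(n/2) < √kₙ < (3·C₂/2)·λ^(n/2). -/
open Polynomial

/-- If a depressed irreducible rational cubic has `θ` as its only real root, then the discriminant
of the complementary quadratic factor is negative. -/
lemma three_mul_sq_sub_four_mul_pos (p q : ℤ) (θ : ℝ)
    (hirr : Irreducible (X ^ 3 - C (p : ℚ) * X - C (q : ℚ)))
    (hroot : θ ^ 3 - (p : ℝ) * θ - (q : ℝ) = 0)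
    (huniq : ∀ x : ℝ, x ^ 3 - (p : ℝ) * x - (q : ℝ) = 0 → x = θ) :
    0 < 3 * θ ^ 2 - 4 * (p : ℝ) := by
  by_contra! h
  have hsq : Real.sqrt (4 * p - 3 * θ ^ 2) ^ 2 = 4 * p - 3 * θ ^ 2 :=
    Real.sq_sqrt (by linarith)
  set r := Real.sqrt (4 * p - 3 * θ ^ 2)
  have h₁ := huniq ((-θ + r) / 2) (by linear_combination hroot + (r - 3 * θ) / 8 * hsq)
  have h₂ := huniq ((-θ - r) / 2) (by linear_combination hroot - (r + 3 * θ) / 8 * hsq)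
  have hθ : θ = 0 := by linarith
  have hr : r = 0 := by linarith
  have hp : (p : ℝ) = 0 := by rw [hr, hθ] at hsq; linarith
  have hq : (q : ℝ) = 0 := by rw [hθ] at hroot; linarith
  have hp' : p = 0 := by exact_mod_cast hp
  have hq' : q = 0 := by exact_mod_cast hq
  subst hp' hq'
  have : Irreducible ((X : ℚ[X]) ^ 3) := by simpa using hirr
  exact not_irreducible_pow (by norm_num) this

/-- A number of the form `a + b θ + c θ²` that is integral over `ℤ`, where `θ` is a root of an
irreducible polynomial, stays integral when `θ` is replaced by any other root; the same holds
for its inverse, and being nonzero is preserved too. -/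
lemma isIntegral_conjugate {f : ℚ[X]} (hirr : Irreducible f) {θ : ℝ} {η : ℂ}
    (hθ : aeval θ f = 0) (hη : aeval η f = 0) (a b c : ℚ) :
    (IsIntegral ℤ ((a : ℝ) + b * θ + c * θ ^ 2) →
      IsIntegral ℤ ((a : ℂ) + b * η + c * η ^ 2)) ∧
    (IsIntegral ℤ ((a : ℝ) + b * θ + c * θ ^ 2)⁻¹ →
      IsIntegral ℤ ((a : ℂ) + b * η + c * η ^ 2)⁻¹) ∧
    ((a : ℝ) + b * θ + c * θ ^ 2 ≠ 0 → (a : ℂ) + b * η + c * η ^ 2 ≠ 0) := by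
  have : Fact (Irreducible f) := ⟨hirr⟩
  let φ : AdjoinRoot f →ₐ[ℚ] ℝ := AdjoinRoot.liftAlgHom f (Algebra.ofId ℚ ℝ) θ hθ
  let ψ : AdjoinRoot f →ₐ[ℚ] ℂ := AdjoinRoot.liftAlgHom f (Algebra.ofId ℚ ℂ) η hη
  have transfer (y : AdjoinRoot f) (hy : IsIntegral ℤ (φ y)) : IsIntegral ℤ (ψ y) := by
    have hy' : IsIntegral ℤ y :=
      (isIntegral_algHom_iff (φ.restrictScalars ℤ) φ.toRingHom.injective).mp hy
    exact hy'.map (ψ.restrictScalars ℤ)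
  let x : AdjoinRoot f := algebraMap ℚ _ a + algebraMap ℚ _ b * AdjoinRoot.root f
    + algebraMap ℚ _ c * AdjoinRoot.root f ^ 2
  have hφ : φ x = (a : ℝ) + b * θ + c * θ ^ 2 := by
    simp only [x, map_add, map_mul, map_pow, eq_ratCast, map_ratCast]
    rw [show φ (AdjoinRoot.root f) = θ from AdjoinRoot.liftAlgHom_root ..]
  have hψ : ψ x = (a : ℂ) + b * η + c * η ^ 2 := by
    simp only [x, map_add, map_mul, map_pow, eq_ratCast, map_ratCast]
    rw [show ψ (AdjoinRoot.root f) = η from AdjoinRoot.liftAlgHom_root ..]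
  rw [← hφ, ← hψ, ← map_inv₀, ← map_inv₀]
  refine ⟨transfer _, transfer _, fun h => ?_⟩
  rw [_root_.map_ne_zero] at h ⊢
  exact h

/-- A positive rational number which together with its inverse is integral over `ℤ` equals `1`. -/
lemma eq_one_of_isIntegral_of_isIntegral_inv {N : ℚ} (hN : 0 < N)
    (h : IsIntegral ℤ N) (hinv : IsIntegral ℤ N⁻¹) : N = 1 := by
  obtain ⟨z, hz⟩ := IsIntegrallyClosed.isIntegral_iff.mp h
  obtain ⟨w, hw⟩ := IsIntegrallyClosed.isIntegral_iff.mp hinv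
  simp only [eq_intCast] at hz hw
  have hzw : z * w = 1 := by
    have : (z : ℚ) * w = 1 := by rw [hz, hw, mul_inv_cancel₀ hN.ne']
    exact_mod_cast this
  have hz0 : 0 < z := by rw [← hz] at hN; exact_mod_cast hN
  have hz1 : z = 1 := by
    rcases Int.eq_one_or_neg_one_of_mul_eq_one hzw with h | h <;> omega
  rw [← hz, hz1, Int.cast_one]

/-- For a positive unit `a + b θ + c θ²` of the cubic field, the squared absolute value of its
complex conjugate `a + b η + c η²`, with `η = -θ/2 + i s`, is the inverse of the unit. -/
lemma unit_mul_normSq_conjugate (p q : ℤ) (θ s : ℝ)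
    (hirr : Irreducible (X ^ 3 - C (p : ℚ) * X - C (q : ℚ)))
    (hroot : θ ^ 3 - (p : ℝ) * θ - (q : ℝ) = 0)
    (hs : 4 * s ^ 2 = 3 * θ ^ 2 - 4 * (p : ℝ))
    (a b c : ℚ) (L : ℝ) (hL : L = a + b * θ + c * θ ^ 2) (hL0 : 0 < L)
    (hint : IsIntegral ℤ L) (hinv : IsIntegral ℤ L⁻¹) :
    L * ((a - b * θ / 2 + c * (p - θ ^ 2 / 2)) ^ 2 + (b * s - c * θ * s) ^ 2) = 1 := by
  set u : ℝ := a - b * θ / 2 + c * (p - θ ^ 2 / 2) with hu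
  set v : ℝ := b * s - c * θ * s with hv
  set η : ℂ := -θ / 2 + s * Complex.I with hη
  have hrootC : (θ : ℂ) ^ 3 - p * θ - q = 0 := by exact_mod_cast hroot
  have hsC : 4 * (s : ℂ) ^ 2 = 3 * θ ^ 2 - 4 * p := by exact_mod_cast hs
  have hI : Complex.I ^ 2 = -1 := Complex.I_sq
  have hηsq : η ^ 2 = -θ * η - θ ^ 2 + p := by
    rw [hη]
    linear_combination (s : ℂ) ^ 2 * hI - hsC / 4
  have hθf : aeval θ (X ^ 3 - C (p : ℚ) * X - C (q : ℚ)) = 0 := by simpa using hroot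
  have hηf : aeval η (X ^ 3 - C (p : ℚ) * X - C (q : ℚ)) = 0 := by
    have : η ^ 3 - p * η - q = 0 := by linear_combination (η - θ) * hηsq + hrootC
    simpa using this
  have hμ : (a : ℂ) + b * η + c * η ^ 2 = u + v * Complex.I := by
    rw [hηsq, hη, hu, hv]
    push_cast
    ring
  obtain ⟨hm, hm', hm0⟩ := isIntegral_conjugate hirr hθf hηf a b c
  rw [← hL, hμ] at hm hm' hm0
  let conj : ℂ →ₐ[ℤ] ℂ := Complex.conjAe.toAlgHom.restrictScalars ℤ
  have hnorm : (L : ℂ) * ((u + v * Complex.I) * conj (u + v * Complex.I))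
      = ((L * (u ^ 2 + v ^ 2) : ℝ) : ℂ) := by
    have : conj (u + v * Complex.I) = u - v * Complex.I := by
      simp [conj, sub_eq_add_neg]
    rw [this]
    push_cast
    linear_combination -(L : ℂ) * v ^ 2 * hI
  have hLC : IsIntegral ℤ (L : ℂ) := hint.map (Complex.ofRealAm.restrictScalars ℤ)
  have hLC' : IsIntegral ℤ (L : ℂ)⁻¹ := by
    rw [← Complex.ofReal_inv]
    exact hinv.map (Complex.ofRealAm.restrictScalars ℤ)
  have hNint := hLC.mul ((hm hint).mul ((hm hint).map conj))
  have hNinv := hLC'.mul ((hm' hinv).mul ((hm' hinv).map conj))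
  rw [map_inv₀, ← mul_inv, ← mul_inv] at hNinv
  set N : ℚ := a ^ 3 + 2 * p * a ^ 2 * c - p * a * b ^ 2 + p ^ 2 * a * c ^ 2 - 3 * q * a * b * c
    + q * b ^ 3 - p * q * b * c ^ 2 + q ^ 2 * c ^ 3 with hN
  have hNeq : L * (u ^ 2 + v ^ 2) = (N : ℝ) := by
    rw [hN, hL, hu, hv]
    push_cast
    linear_combination (a + b * θ + c * θ ^ 2 : ℝ) * (b - c * θ) ^ 2 / 4 * hs
      + (b ^ 3 - 3 * a * b * c - p * b * c ^ 2 + c ^ 3 * (θ ^ 3 - p * θ + q)) * hroot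
  rw [hnorm, hNeq, Complex.ofReal_ratCast, ← eq_ratCast (algebraMap ℚ ℂ)] at hNint hNinv
  rw [← map_inv₀] at hNinv
  have hinj : Function.Injective (algebraMap ℚ ℂ) := (algebraMap ℚ ℂ).injective
  have hNpos : 0 < N := by
    have hne : N ≠ 0 := by
      intro h0
      rw [h0, Rat.cast_zero] at hNeq
      have huv : u ^ 2 + v ^ 2 = 0 := (mul_eq_zero.mp hNeq).resolve_left hL0.ne'
      have hv0 : v = 0 := by nlinarith [sq_nonneg u, sq_nonneg v]
      have hu0 : u = 0 := by nlinarith [sq_nonneg u, sq_nonneg v]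
      exact hm0 hL0.ne' (by rw [hu0, hv0]; simp)
    have : (0 : ℝ) ≤ N := by rw [← hNeq]; positivity
    exact lt_of_le_of_ne (by exact_mod_cast this) hne.symm
  rw [hNeq, eq_one_of_isIntegral_of_isIntegral_inv hNpos ((isIntegral_algebraMap_iff hinj).mp hNint)
    ((isIntegral_algebraMap_iff hinj).mp hNinv), Rat.cast_one]

/-- **Corollary.** With the usual setup (including `d` with `O_K ⊆ (1/d)ℤ[θ]` and `kₙ = d cₙ`,
`C₂ = √d/√(3θ² - p)`), if `λ^(3n/2) > 2(1+√2)C₁` then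
`(C₂/2)λ^(n/2) < √kₙ < (3C₂/2)λ^(n/2)`. -/
theorem sqrt_kn_bounds
    (p q : ℤ) (θ : ℝ)
    (hirr : Irreducible (X ^ 3 - C (p : ℚ) * X - C (q : ℚ)))
    (hroot : θ ^ 3 - (p : ℝ) * θ - (q : ℝ) = 0)
    (huniq : ∀ x : ℝ, x ^ 3 - (p : ℝ) * x - (q : ℝ) = 0 → x = θ)
    (d : ℕ) (hd0 : 0 < d)
    (hd : ∀ x : ℝ, IsIntegral ℤ x → (∃ u v w : ℚ, x = (u : ℝ) + (v : ℝ) * θ + (w : ℝ) * θ ^ 2) →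
      ∃ e f g : ℤ, (d : ℝ) * x = (e : ℝ) + (f : ℝ) * θ + (g : ℝ) * θ ^ 2)
    (lam : ℝ) (hlam : 1 < lam)
    (hint : IsIntegral ℤ lam) (hintinv : IsIntegral ℤ lam⁻¹)
    (a b c : ℕ → ℚ)
    (hcoord : ∀ n : ℕ, 1 ≤ n →
      lam ^ n = (a n : ℝ) + (b n : ℝ) * θ + (c n : ℝ) * θ ^ 2)
    (C₁ : ℝ)
    (hC₁ : C₁ = max (Real.sqrt 2) (Real.sqrt 2 * |θ| / Real.sqrt (3 * θ ^ 2 - 4 * (p : ℝ))))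
    (C₂ : ℝ) (hC₂ : C₂ = Real.sqrt d / Real.sqrt (3 * θ ^ 2 - (p : ℝ)))
    (k : ℕ → ℝ) (hk : ∀ n, k n = (d : ℝ) * (c n : ℝ))
    (n : ℕ) (hn : 1 ≤ n)
    (hbig : lam ^ (3 * (n : ℝ) / 2) > 2 * (1 + Real.sqrt 2) * C₁) :
    (C₂ / 2) * lam ^ ((n : ℝ) / 2) < Real.sqrt (k n) ∧
    Real.sqrt (k n) < (3 * C₂ / 2) * lam ^ ((n : ℝ) / 2) := by
  have hdisc := three_mul_sq_sub_four_mul_pos p q θ hirr hroot huniq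
  set R := Real.sqrt (3 * θ ^ 2 - 4 * (p : ℝ)) with hR
  have hR0 : 0 < R := Real.sqrt_pos.mpr hdisc
  have hRsq : R ^ 2 = 3 * θ ^ 2 - 4 * (p : ℝ) := Real.sq_sqrt hdisc.le
  have hD : 0 < 3 * θ ^ 2 - (p : ℝ) := by nlinarith [sq_nonneg θ]
  have hlam0 : 0 < lam := by linarith
  set L := lam ^ n with hLdef
  have hL0 : 0 < L := by positivity
  have hLinv : IsIntegral ℤ L⁻¹ := by rw [hLdef, ← inv_pow]; exact hintinv.pow n
  have hunit := unit_mul_normSq_conjugate p q θ (R / 2) hirr hroot (by linarith)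
    (a n) (b n) (c n) L (hcoord n hn) hL0 (hint.pow n) hLinv
  have hLc := hcoord n hn
  set u : ℝ := a n - b n * θ / 2 + c n * (p - θ ^ 2 / 2) with hu
  set v : ℝ := b n * (R / 2) - c n * θ * (R / 2) with hv
  set t := θ / R with ht
  have htR : t * R = θ := by rw [ht]; field_simp
  have hc : (3 * θ ^ 2 - p) * (c n : ℝ) = L - (u + 3 * t * v) := by
    rw [hLdef, hLc, hu, hv]
    linear_combination (3 / 2 * (b n : ℝ) - 3 / 2 * c n * θ) * htR
  have hC1a : Real.sqrt 2 ≤ C₁ := hC₁ ▸ le_max_left _ _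
  have hC1b : Real.sqrt 2 * |t| ≤ C₁ := by
    rw [ht, abs_div, abs_of_pos hR0, ← mul_div_assoc]
    exact hC₁ ▸ le_max_right _ _
  have h2 : Real.sqrt 2 ^ 2 = 2 := Real.sq_sqrt (by norm_num)
  have h20 : 0 ≤ Real.sqrt 2 := Real.sqrt_nonneg 2
  have hC1sq : 2 ≤ C₁ ^ 2 := by
    rw [← h2]
    gcongr
  have hC1tsq : 2 * t ^ 2 ≤ C₁ ^ 2 := by
    rw [← h2, ← sq_abs t, ← mul_pow]
    gcongr
  have hC1pos : 0 ≤ C₁ := h20.trans hC1a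
  have hbigsq : 20 * C₁ ^ 2 < L ^ 3 := by
    have hpow : (lam ^ (3 * (n : ℝ) / 2)) ^ 2 = L ^ 3 := by
      rw [hLdef, ← Real.rpow_natCast, ← Real.rpow_mul hlam0.le, ← pow_mul, ← Real.rpow_natCast]
      congr 1
      push_cast
      ring
    rw [← hpow]
    have hsq : (2 * (1 + Real.sqrt 2) * C₁) ^ 2 < (lam ^ (3 * (n : ℝ) / 2)) ^ 2 := by
      gcongr
    have h1 : 1 ≤ Real.sqrt 2 := Real.one_le_sqrt.mpr (by norm_num)
    refine lt_of_le_of_lt ?_ hsq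
    have h5 : 5 ≤ (1 + Real.sqrt 2) ^ 2 := by nlinarith
    calc 20 * C₁ ^ 2 = 4 * 5 * C₁ ^ 2 := by ring
      _ ≤ 4 * (1 + Real.sqrt 2) ^ 2 * C₁ ^ 2 := by gcongr
      _ = (2 * (1 + Real.sqrt 2) * C₁) ^ 2 := by ring
  have herr : (u + 3 * t * v) ^ 2 < (L / 2) ^ 2 := by
    have hcs : (u + 3 * t * v) ^ 2 ≤ (1 + 9 * t ^ 2) * (u ^ 2 + v ^ 2) := by
      linarith [sq_nonneg (v - 3 * t * u), show (1 + 9 * t ^ 2) * (u ^ 2 + v ^ 2)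
        - (u + 3 * t * v) ^ 2 = (v - 3 * t * u) ^ 2 by ring]
    have hle : (1 + 9 * t ^ 2) * (u ^ 2 + v ^ 2) ≤ 5 * C₁ ^ 2 * (u ^ 2 + v ^ 2) := by
      gcongr
      linarith
    refine lt_of_mul_lt_mul_left ?_ hL0.le
    calc L * (u + 3 * t * v) ^ 2 ≤ L * (5 * C₁ ^ 2 * (u ^ 2 + v ^ 2)) := by
          gcongr
          exact hcs.trans hle
      _ = 5 * C₁ ^ 2 * (L * (u ^ 2 + v ^ 2)) := by ring
      _ = 5 * C₁ ^ 2 := by rw [hunit, mul_one]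
      _ < L * (L / 2) ^ 2 := by linarith [show L * (L / 2) ^ 2 = L ^ 3 / 4 by ring]
  obtain ⟨hlo, hhi⟩ := abs_lt.mp (abs_lt_of_sq_lt_sq herr (by positivity))
  have hd' : (0 : ℝ) < d := by exact_mod_cast hd0
  have hC2sq : C₂ ^ 2 = d / (3 * θ ^ 2 - p) := by
    rw [hC₂, div_pow, Real.sq_sqrt hd'.le, Real.sq_sqrt hD.le]
  have hC20 : 0 < C₂ := by rw [hC₂]; positivity
  have hkn : k n = C₂ ^ 2 * (L - (u + 3 * t * v)) := by
    rw [hk, ← hc, hC2sq]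
    field_simp
  have hhalf : (lam ^ ((n : ℝ) / 2)) ^ 2 = L := by
    rw [hLdef, ← Real.rpow_natCast, ← Real.rpow_mul hlam0.le, ← Real.rpow_natCast]
    congr 1
    push_cast
    ring
  have hpos : 0 < C₂ ^ 2 * L := by positivity
  have hlow : C₂ ^ 2 * (L / 2) < k n := by
    rw [hkn]
    gcongr
    linarith
  have hupp : k n < C₂ ^ 2 * (3 * L / 2) := by
    rw [hkn]
    gcongr
    linarith
  constructor
  · apply Real.lt_sqrt_of_sq_lt
    rw [mul_pow, hhalf]
    linarith [show (C₂ / 2) ^ 2 * L = C₂ ^ 2 * L / 4 by ring]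
  · rw [Real.sqrt_lt' (by positivity), mul_pow, hhalf]
    linarith [show (3 * C₂ / 2) ^ 2 * L = 9 * (C₂ ^ 2 * L) / 4 by ring]
end

section
/- If α, β ∈ ℝ are such that 1, α, β are linearly dependent over ℚ, then there exist a strictly increasing sequence {kₙ} of positive integers and a constant C > 0 such that kₙ·‖kₙ·α‖ ≤ C and kₙ·‖kₙ·β‖ ≤ C for all n. Consequently liminf_{n→∞} n·‖n·α‖·‖n·β‖ = 0. -/
open Filter

/-- Distance from a real number to the nearest integer. -/
noncomputable def distNearestInt (x : ℝ) : ℝ := |x - round x|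

theorem distNearestInt_nonneg (x : ℝ) : 0 ≤ distNearestInt x := abs_nonneg _

theorem distNearestInt_le_abs_sub_intCast (x : ℝ) (z : ℤ) : distNearestInt x ≤ |x - z| :=
  round_le x z

/-- An integer affine combination scales the distance to the nearest integer by at most the
absolute value of the leading coefficient. -/
theorem distNearestInt_intCast_mul_add_intCast_le (a b : ℤ) (x : ℝ) :
    distNearestInt (a * x + b) ≤ |(a : ℝ)| * distNearestInt x := by
  refine (distNearestInt_le_abs_sub_intCast _ (a * round x + b)).trans_eq ?_
  rw [distNearestInt, ← abs_mul]
  push_cast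
  ring_nf

/-- Dirichlet's approximation theorem with arbitrarily large denominators, for any real number
(rational or not). -/
theorem exists_ge_mul_distNearestInt_le_one (ξ : ℝ) (N : ℕ) :
    ∃ k : ℕ, N ≤ k ∧ 0 < k ∧ (k : ℝ) * distNearestInt (k * ξ) ≤ 1 := by
  by_contra! h
  have small : ∀ n : ℕ, 0 < n →
      ∃ k ∈ Finset.Ico 1 N, distNearestInt (k * ξ) ≤ 1 / ((n : ℝ) + 1) := by
    intro n hn
    obtain ⟨k, hk, hkn, hle⟩ := Real.exists_nat_abs_mul_sub_round_le ξ hn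
    change distNearestInt (k * ξ) ≤ _ at hle
    refine ⟨k, Finset.mem_Ico.2 ⟨hk, not_le.1 fun hNk => ?_⟩, hle⟩
    have hkn' : (k : ℝ) ≤ n := by exact_mod_cast hkn
    refine (h k hNk hk).not_ge ((mul_le_mul_of_nonneg_left hle k.cast_nonneg).trans ?_)
    rw [mul_one_div, div_le_one (by positivity)]
    linarith
  obtain ⟨k₁, hk₁, -⟩ := small 1 one_pos
  obtain ⟨k, hk, hmin⟩ :=
    Finset.exists_min_image (Finset.Ico 1 N) (fun k : ℕ => distNearestInt (k * ξ)) ⟨k₁, hk₁⟩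
  obtain ⟨hk_pos, hkN⟩ := Finset.mem_Ico.1 hk
  have hzero : distNearestInt (k * ξ) = 0 := by
    refine le_antisymm (le_of_forall_pos_le_add fun ε hε => ?_) (distNearestInt_nonneg _)
    obtain ⟨n, hn⟩ := exists_nat_one_div_lt hε
    obtain ⟨j, hj, hjle⟩ := small (n + 1) n.succ_pos
    have hanti : 1 / (((n + 1 : ℕ) : ℝ) + 1) ≤ 1 / ((n : ℝ) + 1) :=
      one_div_le_one_div_of_le (by positivity) (by push_cast; linarith)
    linarith [hmin j hj]
  have hmul := distNearestInt_intCast_mul_add_intCast_le N 0 (k * ξ)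
  rw [hzero, mul_zero] at hmul
  have hlt := h (N * k) (Nat.le_mul_of_pos_right N hk_pos) (Nat.mul_pos (by omega) hk_pos)
  have hle : distNearestInt (((N * k : ℕ) : ℝ) * ξ) ≤ 0 := by
    convert hmul using 2
    push_cast
    ring
  linarith [mul_nonpos_of_nonneg_of_nonpos (N * k).cast_nonneg hle]

/-- If `β` is a rational affine function of `α`, then `α` and `β` are simultaneously well
approximable with arbitrarily large denominators. -/
theorem frequently_mul_distNearestInt_le_of_eq_ratCast_mul_add {α β : ℝ} {p q : ℚ}
    (h : β = p * α + q) :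
    ∃ C : ℝ, 0 < C ∧ ∃ᶠ k : ℕ in atTop, 0 < k ∧
      (k : ℝ) * distNearestInt (k * α) ≤ C ∧ (k : ℝ) * distNearestInt (k * β) ≤ C := by
  set d : ℕ := p.den * q.den with hd
  set a : ℤ := p.num * q.den with ha
  set b : ℤ := q.num * p.den with hb
  have hd_pos : 0 < d := Nat.mul_pos p.pos q.pos
  have hdR : (0 : ℝ) < d := by exact_mod_cast hd_pos
  have hdβ : (d : ℝ) * β = a * α + b := by
    have hp : (p : ℝ) * p.den = p.num := by exact_mod_cast p.mul_den_eq_num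
    have hq : (q : ℝ) * q.den = q.num := by exact_mod_cast q.mul_den_eq_num
    rw [h, hd, ha, hb]
    push_cast
    rw [← hp, ← hq]
    ring
  refine ⟨d * d + d * |(a : ℝ)|, by positivity, frequently_atTop.2 fun N => ?_⟩
  obtain ⟨m, hNm, hm, hle⟩ := exists_ge_mul_distNearestInt_le_one α N
  have hα : distNearestInt ((d * m : ℕ) * α) ≤ d * distNearestInt (m * α) := by
    convert distNearestInt_intCast_mul_add_intCast_le d 0 (m * α) using 2
    · push_cast
      ring
    · simp
  have hβ : distNearestInt ((d * m : ℕ) * β) ≤ |(a : ℝ)| * distNearestInt (m * α) := by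
    convert distNearestInt_intCast_mul_add_intCast_le a (m * b) (m * α) using 2
    push_cast
    linear_combination (m : ℝ) * hdβ
  have bound : ∀ {x c : ℝ}, 0 ≤ c → x ≤ c * distNearestInt (m * α) →
      ((d * m : ℕ) : ℝ) * x ≤ d * c := by
    intro x c hc hx
    calc ((d * m : ℕ) : ℝ) * x ≤ (d * m : ℕ) * (c * distNearestInt (m * α)) := by gcongr
      _ = d * c * (m * distNearestInt (m * α)) := by push_cast; ring
      _ ≤ d * c * 1 := by gcongr
      _ = d * c := mul_one _
  refine ⟨d * m, hNm.trans (Nat.le_mul_of_pos_left m hd_pos), Nat.mul_pos hd_pos hm, ?_, ?_⟩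
  · exact (bound hdR.le hα).trans (le_add_of_nonneg_right (by positivity))
  · exact (bound (abs_nonneg _) hβ).trans (le_add_of_nonneg_left (by positivity))

/-- Rational dependence of `1, α, β` gives simultaneous approximations of `α` and `β` with
arbitrarily large denominators. -/
theorem frequently_mul_distNearestInt_le_of_rational_dependence {α β : ℝ}
    (hdep : ∃ c₀ c₁ c₂ : ℚ, ¬(c₀ = 0 ∧ c₁ = 0 ∧ c₂ = 0) ∧
      (c₀ : ℝ) + (c₁ : ℝ) * α + (c₂ : ℝ) * β = 0) :
    ∃ C : ℝ, 0 < C ∧ ∃ᶠ k : ℕ in atTop, 0 < k ∧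
      (k : ℝ) * distNearestInt (k * α) ≤ C ∧ (k : ℝ) * distNearestInt (k * β) ≤ C := by
  obtain ⟨c₀, c₁, c₂, hne, heq⟩ := hdep
  by_cases h₂ : c₂ = 0
  · by_cases h₁ : c₁ = 0
    · subst h₁ h₂
      exact absurd ⟨by simpa using heq, rfl, rfl⟩ hne
    · have h₁' : (c₁ : ℝ) ≠ 0 := by exact_mod_cast h₁
      have hα : α = ((0 : ℚ) : ℝ) * β + ((-c₀ / c₁ : ℚ) : ℝ) := by
        subst h₂
        push_cast at heq ⊢
        field_simp
        linear_combination heq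
      obtain ⟨C, hC, hfreq⟩ := frequently_mul_distNearestInt_le_of_eq_ratCast_mul_add hα
      exact ⟨C, hC, hfreq.mono fun k hk => ⟨hk.1, hk.2.2, hk.2.1⟩⟩
  · have h₂' : (c₂ : ℝ) ≠ 0 := by exact_mod_cast h₂
    refine frequently_mul_distNearestInt_le_of_eq_ratCast_mul_add
      (p := -c₁ / c₂) (q := -c₀ / c₂) ?_
    push_cast
    field_simp
    linear_combination heq

/-- Simultaneous approximations of bounded quality along infinitely many denominators force the
Littlewood `liminf` to vanish. -/
theorem liminf_mul_distNearestInt_mul_eq_zero {α β C : ℝ}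
    (hfreq : ∃ᶠ k : ℕ in atTop, 0 < k ∧
      (k : ℝ) * distNearestInt (k * α) ≤ C ∧ (k : ℝ) * distNearestInt (k * β) ≤ C) :
    liminf (fun n : ℕ => (n : ℝ) * distNearestInt ((n : ℝ) * α)
        * distNearestInt ((n : ℝ) * β)) atTop = 0 := by
  have hnonneg : ∀ n : ℕ, 0 ≤ (n : ℝ) * distNearestInt (n * α) * distNearestInt (n * β) :=
    fun n => mul_nonneg (mul_nonneg n.cast_nonneg (distNearestInt_nonneg _))
      (distNearestInt_nonneg _)
  have hsmall : ∀ ε : ℝ, 0 < ε → ∃ᶠ n : ℕ in atTop,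
      (n : ℝ) * distNearestInt (n * α) * distNearestInt (n * β) ≤ ε := by
    intro ε hε
    have hlim : Tendsto (fun n : ℕ => C * C / (n : ℝ)) atTop (nhds 0) :=
      tendsto_const_div_atTop_nhds_zero_nat (C * C)
    refine (hfreq.and_eventually (hlim.eventually_lt_const hε)).mono ?_
    rintro k ⟨⟨hk, hα, hβ⟩, hlt⟩
    have hkR : (0 : ℝ) < k := by exact_mod_cast hk
    have hC : 0 ≤ C := (mul_nonneg hkR.le (distNearestInt_nonneg _)).trans hα
    refine le_trans ?_ hlt.le
    rw [le_div_iff₀ hkR, mul_assoc, mul_comm (distNearestInt (k * β))]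
    exact mul_le_mul hα hβ (mul_nonneg hkR.le (distNearestInt_nonneg _)) hC
  refine le_antisymm (le_of_forall_pos_le_add fun ε hε => ?_) ?_
  · rw [zero_add]
    exact liminf_le_of_frequently_le (hsmall ε hε)
      (isBoundedUnder_of ⟨0, hnonneg⟩)
  · exact le_liminf_of_le (IsCoboundedUnder.of_frequently_le (hsmall 1 one_pos))
      (Eventually.of_forall hnonneg)

/-- **Lemma.** If `1, α, β` are linearly dependent over `ℚ`, then there is a strictly
increasing sequence `kₙ` of positive integers with `kₙ‖kₙα‖` and `kₙ‖kₙβ‖` bounded;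
consequently `liminf_{n} n‖nα‖‖nβ‖ = 0`. -/
theorem littlewood_of_rational_dependence
    (α β : ℝ)
    (hdep : ∃ c₀ c₁ c₂ : ℚ, ¬(c₀ = 0 ∧ c₁ = 0 ∧ c₂ = 0) ∧
      (c₀ : ℝ) + (c₁ : ℝ) * α + (c₂ : ℝ) * β = 0) :
    (∃ (k : ℕ → ℕ) (Cbd : ℝ), StrictMono k ∧ (∀ n, 0 < k n) ∧ 0 < Cbd ∧
      ∀ n, (k n : ℝ) * distNearestInt ((k n : ℝ) * α) ≤ Cbd ∧
           (k n : ℝ) * distNearestInt ((k n : ℝ) * β) ≤ Cbd) ∧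
    liminf (fun n : ℕ => (n : ℝ) * distNearestInt ((n : ℝ) * α)
        * distNearestInt ((n : ℝ) * β)) atTop = 0 := by
  obtain ⟨C, hC, hfreq⟩ := frequently_mul_distNearestInt_le_of_rational_dependence hdep
  obtain ⟨k, hk, hkC⟩ := extraction_of_frequently_atTop hfreq
  exact ⟨⟨k, C, hk, fun n => (hkC n).1, hC, fun n => (hkC n).2⟩,
    liminf_mul_distNearestInt_mul_eq_zero hfreq⟩
end

section
/- With the setup below, set uₙ = √kₙ·⟨kₙ·θ⟩ and vₙ = √kₙ·⟨kₙ·θ²⟩ for those n with kₙ > 0 (which holds for all sufficiently large n). Then lim_{n→∞} [(θ·uₙ − 2·vₙ)² + (3·θ² − 4·p)·uₙ²] = 4·d³/(3·θ² − p); in particular, the points (uₙ, vₙ) get arbitrarily close to the ellipse (θ·x − 2·y)² + (3·θ² − 4·p)·x² = 4·d³/(3·θ² − p). -/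
open Polynomial Filter

/-- `⟨x⟩ = x - ⌊x + 1/2⌋`, the signed distance from `x` to the nearest integer. -/
noncomputable def signedDistNearestInt (x : ℝ) : ℝ := x - round x

lemma Irreducible.dvd_of_aeval_eq_zero {F A : Type*} [Field F] [Field A] [Algebra F A]
    {f P : F[X]} (hf : Irreducible f) {x : A} (hx : aeval x f = 0) (hP : aeval x P = 0) :
    f ∣ P :=
  ((minpoly.irreducible (IsAlgebraic.isIntegral ⟨f, hf.ne_zero, hx⟩)).associated_of_dvd hf
    (minpoly.dvd F x hx)).symm.dvd.trans (minpoly.dvd F x hP)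

/-- Two roots of an irreducible polynomial satisfy the same polynomial equations. -/
lemma aeval_eq_zero_of_irreducible_root {F A B : Type*} [Field F] [Field A] [Field B]
    [Algebra F A] [Algebra F B] {f P : F[X]} (hf : Irreducible f) {x : A} {y : B}
    (hx : aeval x f = 0) (hy : aeval y f = 0) (hP : aeval x P = 0) : aeval y P = 0 := by
  obtain ⟨R, rfl⟩ := hf.dvd_of_aeval_eq_zero hx hP
  simp [hy]

/-- `1, x, x²` are linearly independent when `x` is a root of an irreducible cubic; we only
record the vanishing of the leading coefficient. -/
lemma quadratic_coeff_eq_zero_of_irreducible_cubic {f : ℚ[X]} (hf : Irreducible f)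
    (hdeg : f.natDegree = 3) {x : ℝ} (hx : aeval x f = 0) {α β γ : ℚ}
    (h : (α : ℝ) + β * x + γ * x ^ 2 = 0) : γ = 0 := by
  by_contra hγ
  have hP : aeval x (C γ * X ^ 2 + C β * X + C α) = 0 := by
    simp only [map_add, map_mul, map_pow, aeval_X, aeval_C, eq_ratCast]
    linarith
  have hle := natDegree_le_of_dvd (hf.dvd_of_aeval_eq_zero hx hP) fun h0 => by
    simpa [h0] using natDegree_quadratic (a := γ) (b := β) (c := α) hγ
  rw [natDegree_quadratic hγ] at hle
  omega

/-- A polynomial expression in a second root is integral as soon as it is in the first. -/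
lemma isIntegral_aeval_of_irreducible_root {A B : Type*} [Field A] [Field B]
    [Algebra ℚ A] [Algebra ℚ B] {f L : ℚ[X]} (hf : Irreducible f) {x : A} {y : B}
    (hx : aeval x f = 0) (hy : aeval y f = 0) (hL : IsIntegral ℤ (aeval x L)) :
    IsIntegral ℤ (aeval y L) := by
  obtain ⟨G, hG, hG0⟩ := hL
  refine ⟨G, hG, ?_⟩
  have h1 : aeval x ((G.map (algebraMap ℤ ℚ)).comp L) = 0 := by
    rw [aeval_comp, aeval_map_algebraMap]; exact hG0
  have h2 := aeval_eq_zero_of_irreducible_root hf hx hy h1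
  rw [aeval_comp, aeval_map_algebraMap] at h2
  exact h2

lemma isIntegral_inv_aeval_of_irreducible_root {A B : Type*} [Field A] [Field B]
    [Algebra ℚ A] [Algebra ℚ B] {f L : ℚ[X]} (hf : Irreducible f) {x : A} {y : B}
    (hx : aeval x f = 0) (hy : aeval y f = 0) (hL : IsIntegral ℤ (aeval x L)⁻¹) :
    IsIntegral ℤ (aeval y L)⁻¹ := by
  by_cases h0 : aeval y L = 0
  · rw [h0, inv_zero]; exact isIntegral_zero
  have hx0 : aeval x L ≠ 0 := fun h => h0 (aeval_eq_zero_of_irreducible_root hf hx hy h)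
  obtain ⟨G, hG, hG0⟩ := hL
  refine ⟨G, hG, ?_⟩
  have h1 : aeval x ((G.reverse.map (algebraMap ℤ ℚ)).comp L) = 0 := by
    rw [aeval_comp, aeval_map_algebraMap]
    let := invertibleOfNonzero (inv_ne_zero hx0)
    have := (eval₂_reverse_eq_zero_iff (algebraMap ℤ A) (aeval x L)⁻¹ G).2 hG0
    rwa [invOf_eq_inv, inv_inv] at this
  have h2 := aeval_eq_zero_of_irreducible_root hf hx hy h1
  rw [aeval_comp, aeval_map_algebraMap] at h2
  let := invertibleOfNonzero (inv_ne_zero h0)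
  apply (eval₂_reverse_eq_zero_iff (algebraMap ℤ B) (aeval y L)⁻¹ G).1
  rwa [invOf_eq_inv, inv_inv]

/-- A positive rational which is an algebraic integer together with its inverse equals `1`. -/
lemma Rat.eq_one_of_isIntegral_of_isIntegral_inv {m : ℚ} (hm : 0 < m)
    (h1 : IsIntegral ℤ m) (h2 : IsIntegral ℤ m⁻¹) : m = 1 := by
  obtain ⟨i, hi⟩ := IsIntegrallyClosed.isIntegral_iff.1 h1
  obtain ⟨j, hj⟩ := IsIntegrallyClosed.isIntegral_iff.1 h2
  simp only [eq_intCast] at hi hj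
  have hij : i * j = 1 := by
    have : (i : ℚ) * j = 1 := by rw [hi, hj, mul_inv_cancel₀ hm.ne']
    exact_mod_cast this
  rcases Int.eq_one_or_neg_one_of_mul_eq_one hij with h | h
  · rw [← hi, h]; simp
  · rw [h] at hi; norm_num at hi; linarith

/-- If `θ` is the only real root of an irreducible cubic `X³ - p X - q`, then the quadratic factor
`X² + θ X + θ² - p` has negative discriminant. -/
lemma four_mul_lt_three_mul_sq_of_unique_root {p q : ℤ} {θ : ℝ}
    (hirr : Irreducible (X ^ 3 - C (p : ℚ) * X - C (q : ℚ)))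
    (hroot : θ ^ 3 - (p : ℝ) * θ - (q : ℝ) = 0)
    (huniq : ∀ x : ℝ, x ^ 3 - (p : ℝ) * x - (q : ℝ) = 0 → x = θ) :
    0 < 3 * θ ^ 2 - 4 * (p : ℝ) := by
  by_contra! h
  have hs : √(4 * p - 3 * θ ^ 2) ^ 2 = 4 * p - 3 * θ ^ 2 := Real.sq_sqrt (by linarith)
  generalize √(4 * p - 3 * θ ^ 2) = r at hs
  have h1 := huniq ((-θ + r) / 2) (by linear_combination hroot + (r - 3 * θ) / 8 * hs)
  have h2 := huniq ((-θ - r) / 2) (by linear_combination hroot + (-r - 3 * θ) / 8 * hs)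
  have hθ : θ = 0 := by linarith
  have hq : q = 0 := by
    rw [hθ] at hroot
    have : (q : ℝ) = 0 := by linarith
    exact_mod_cast this
  have hfac : (X ^ 3 - C (p : ℚ) * X - C (q : ℚ)) = X * (X ^ 2 - C (p : ℚ)) := by
    rw [hq]; simp only [Int.cast_zero, C_0]; ring
  rw [hfac] at hirr
  rcases hirr.isUnit_or_isUnit rfl with hu | hu
  · exact not_isUnit_X hu
  · have := natDegree_eq_zero_of_isUnit hu
    rw [natDegree_X_pow_sub_C] at this
    omega

lemma depressed_cubic_natDegree (p q : ℤ) :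
    (X ^ 3 - C (p : ℚ) * X - C (q : ℚ)).natDegree = 3 := by
  compute_degree!

lemma sq_eq_of_re_of_im {p θ : ℝ} {z : ℂ} (hre : z.re = -θ / 2)
    (him : z.im ^ 2 = (3 * θ ^ 2 - 4 * p) / 4) : z ^ 2 = -θ * z - (θ ^ 2 - p) := by
  apply Complex.ext
  · simp [pow_two, hre]; linear_combination -him
  · simp [pow_two, hre]; ring

/-- The squared modulus of `a + b z + c z²`, where `z` is a root of `X² + θ X + θ² - p`. -/
lemma normSq_quadratic_conj {p θ a b c : ℝ} {z : ℂ} (hre : z.re = -θ / 2)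
    (him : z.im ^ 2 = (3 * θ ^ 2 - 4 * p) / 4) :
    Complex.normSq (a + b * z + c * z ^ 2) =
      (a - c * (θ ^ 2 - p)) ^ 2 - θ * (a - c * (θ ^ 2 - p)) * (b - c * θ)
        + (θ ^ 2 - p) * (b - c * θ) ^ 2 := by
  have hz := sq_eq_of_re_of_im hre him
  have : (a + b * z + c * z ^ 2 : ℂ) =
      ((a - c * (θ ^ 2 - p) : ℝ) : ℂ) + ((b - c * θ : ℝ) : ℂ) * z := by
    push_cast; linear_combination c * hz
  rw [this]
  generalize a - c * (θ ^ 2 - p) = s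
  generalize b - c * θ = t
  simp [Complex.normSq_apply, hre]
  linear_combination t ^ 2 * him

/-- The complex conjugate of a positive unit `lam` of the cubic field has squared modulus
`lam⁻¹`. -/
lemma normSq_conj_unit {p q : ℤ} {θ : ℝ} {z : ℂ}
    (hirr : Irreducible (X ^ 3 - C (p : ℚ) * X - C (q : ℚ)))
    (hθ : aeval θ (X ^ 3 - C (p : ℚ) * X - C (q : ℚ)) = 0)
    (hz : aeval z (X ^ 3 - C (p : ℚ) * X - C (q : ℚ)) = 0)
    (hre : z.re = -θ / 2) (him : z.im ^ 2 = (3 * θ ^ 2 - 4 * p) / 4)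
    {lam : ℝ} (hlam : 0 < lam) (hint : IsIntegral ℤ lam) (hintinv : IsIntegral ℤ lam⁻¹)
    {L : ℚ[X]} {a b c : ℚ} (hL : L = C a + C b * X + C c * X ^ 2) (hlamL : lam = aeval θ L) :
    Complex.normSq (aeval z L) = lam⁻¹ := by
  set m : ℚ := a ^ 3 + b ^ 3 * q + c ^ 3 * q ^ 2 + 2 * a ^ 2 * c * p + a * c ^ 2 * p ^ 2
    - a * b ^ 2 * p - b * c ^ 2 * p * q - 3 * a * b * c * q with hm
  have hq : (q : ℝ) = θ ^ 3 - p * θ := by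
    simp at hθ; linarith
  have hN : lam * Complex.normSq (aeval z L) = m := by
    have hzL : aeval z L = ((a : ℝ) + (b : ℝ) * z + (c : ℝ) * z ^ 2 : ℂ) := by simp [hL]
    rw [hzL, normSq_quadratic_conj hre him, hlamL, hL, hm]
    push_cast
    rw [hq]
    simp
    ring
  have hne : aeval z L ≠ 0 := fun h0 => hlam.ne'
    (hlamL.trans (aeval_eq_zero_of_irreducible_root hirr hz hθ h0))
  have hmpos : 0 < m := by
    have : (0 : ℝ) < m := hN ▸ mul_pos hlam (Complex.normSq_pos.2 hne)
    exact_mod_cast this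
  have hNC : algebraMap ℝ ℂ lam * (aeval z L * (Complex.conjAe.restrictScalars ℤ) (aeval z L))
      = algebraMap ℚ ℂ m := by
    have : (Complex.conjAe.restrictScalars ℤ) (aeval z L) = starRingEnd ℂ (aeval z L) := rfl
    rw [this, Complex.mul_conj]
    simpa using congrArg (fun t : ℝ => (t : ℂ)) hN
  have hτ : IsIntegral ℤ (aeval z L) :=
    isIntegral_aeval_of_irreducible_root hirr hθ hz (hlamL ▸ hint)
  have hτi : IsIntegral ℤ (aeval z L)⁻¹ :=
    isIntegral_inv_aeval_of_irreducible_root hirr hθ hz (hlamL ▸ hintinv)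
  have h1 : IsIntegral ℤ m := by
    rw [← isIntegral_algebraMap_iff (algebraMap ℚ ℂ).injective, ← hNC]
    exact (hint.algebraMap (B := ℂ)).mul (hτ.mul (hτ.map _))
  have h2 : IsIntegral ℤ m⁻¹ := by
    rw [← isIntegral_algebraMap_iff (algebraMap ℚ ℂ).injective, map_inv₀, ← hNC, mul_inv,
      mul_inv, ← map_inv₀ (algebraMap ℝ ℂ), ← map_inv₀ (Complex.conjAe.restrictScalars ℤ)]
    exact (hintinv.algebraMap (B := ℂ)).mul (hτi.mul (hτi.map _))
  rw [Rat.eq_one_of_isIntegral_of_isIntegral_inv hmpos h1 h2, Rat.cast_one] at hN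
  exact eq_inv_of_mul_eq_one_right hN

lemma signedDistNearestInt_add_intCast {x : ℝ} (hx : |x| < 1 / 2) (m : ℤ) :
    signedDistNearestInt (x + m) = x := by
  have h0 : round x = 0 := by
    rw [abs_lt] at hx
    exact round_eq_zero_iff.2 ⟨hx.1.le, hx.2⟩
  rw [signedDistNearestInt, round_add_intCast, h0]
  simp

/-- A sequence along which a positive definite form tends to zero tends to zero. -/
lemma tendsto_zero_of_form {θ Δ : ℝ} (hΔ : 0 < Δ) {x y F : ℕ → ℝ}
    (hF : Tendsto F atTop (nhds 0))
    (hxy : ∀ᶠ n in atTop, (θ * x n - 2 * y n) ^ 2 + Δ * x n ^ 2 = F n) :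
    Tendsto x atTop (nhds 0) ∧ Tendsto y atTop (nhds 0) := by
  have hsq : ∀ w : ℕ → ℝ, Tendsto (fun n => w n ^ 2) atTop (nhds 0) →
      Tendsto w atTop (nhds 0) := fun w hw => by
    rw [tendsto_zero_iff_abs_tendsto_zero]
    simpa [Real.sqrt_sq_eq_abs, Function.comp_def] using hw.sqrt
  have hx : Tendsto x atTop (nhds 0) := by
    refine hsq x (squeeze_zero' (.of_forall fun n => sq_nonneg _) (g := fun n => F n / Δ) ?_ ?_)
    · filter_upwards [hxy] with n hn
      rw [le_div_iff₀ hΔ]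
      nlinarith [sq_nonneg (θ * x n - 2 * y n)]
    · simpa using hF.div_const Δ
  have hw : Tendsto (fun n => θ * x n - 2 * y n) atTop (nhds 0) := by
    refine hsq _ (squeeze_zero' (.of_forall fun n => sq_nonneg _) ?_ hF)
    filter_upwards [hxy] with n hn
    nlinarith [mul_nonneg hΔ.le (sq_nonneg (x n))]
  refine ⟨hx, ?_⟩
  have := ((hx.const_mul θ).sub hw).div_const 2
  simpa using this

/-- **Lemma (equation of the ellipse).** With the usual setup (`kₙ = d cₙ`, which is positive
for all sufficiently large `n`), setting `uₙ = √kₙ ⟨kₙθ⟩` and `vₙ = √kₙ ⟨kₙθ²⟩`, the quantity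
`(θ uₙ - 2 vₙ)² + (3θ² - 4p) uₙ²` tends to `4d³/(3θ² - p)`; in particular the points
`(uₙ, vₙ)` get arbitrarily close to the ellipse
`(θ x - 2 y)² + (3θ² - 4p) x² = 4d³/(3θ² - p)`. -/
theorem ellipse_limit
    (p q : ℤ) (θ : ℝ)
    (hirr : Irreducible (X ^ 3 - C (p : ℚ) * X - C (q : ℚ)))
    (hroot : θ ^ 3 - (p : ℝ) * θ - (q : ℝ) = 0)
    (huniq : ∀ x : ℝ, x ^ 3 - (p : ℝ) * x - (q : ℝ) = 0 → x = θ)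
    (d : ℕ) (hd0 : 0 < d)
    (hd : ∀ x : ℝ, IsIntegral ℤ x → (∃ u v w : ℚ, x = (u : ℝ) + (v : ℝ) * θ + (w : ℝ) * θ ^ 2) →
      ∃ e f g : ℤ, (d : ℝ) * x = (e : ℝ) + (f : ℝ) * θ + (g : ℝ) * θ ^ 2)
    (lam : ℝ) (hlam : 1 < lam)
    (hint : IsIntegral ℤ lam) (hintinv : IsIntegral ℤ lam⁻¹)
    (a b c : ℕ → ℚ)
    (hcoord : ∀ n : ℕ, 1 ≤ n →
      lam ^ n = (a n : ℝ) + (b n : ℝ) * θ + (c n : ℝ) * θ ^ 2)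
    (k : ℕ → ℝ) (hk : ∀ n, k n = (d : ℝ) * (c n : ℝ))
    (u v : ℕ → ℝ)
    (hu : ∀ n, u n = Real.sqrt (k n) * signedDistNearestInt (k n * θ))
    (hv : ∀ n, v n = Real.sqrt (k n) * signedDistNearestInt (k n * θ ^ 2)) :
    (∀ᶠ n in atTop, 0 < k n) ∧
    Tendsto (fun n : ℕ => (θ * u n - 2 * v n) ^ 2 + (3 * θ ^ 2 - 4 * (p : ℝ)) * (u n) ^ 2)
      atTop (nhds (4 * (d : ℝ) ^ 3 / (3 * θ ^ 2 - (p : ℝ)))) := by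
  have hΔ := four_mul_lt_three_mul_sq_of_unique_root hirr hroot huniq
  have hD : 0 < 3 * θ ^ 2 - (p : ℝ) := by nlinarith [sq_nonneg θ]
  have hθ : aeval θ (X ^ 3 - C (p : ℚ) * X - C (q : ℚ)) = 0 := by simpa using hroot
  have hd' : (0 : ℝ) < d := by exact_mod_cast hd0
  have hlam0 : 0 < lam := one_pos.trans hlam
  obtain ⟨z, hre, him⟩ : ∃ z : ℂ, z.re = -θ / 2 ∧ z.im ^ 2 = (3 * θ ^ 2 - 4 * p) / 4 :=
    ⟨⟨-θ / 2, √((3 * θ ^ 2 - 4 * p) / 4)⟩, rfl, Real.sq_sqrt (by positivity)⟩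
  have hz : aeval z (X ^ 3 - C (p : ℚ) * X - C (q : ℚ)) = 0 := by
    have hz2 := sq_eq_of_re_of_im hre him
    rw [Complex.ofReal_intCast] at hz2
    have hrootC : (θ : ℂ) ^ 3 - p * θ - q = 0 := by exact_mod_cast hroot
    simp only [map_sub, map_mul, map_pow, aeval_X, aeval_C, eq_ratCast, Rat.cast_intCast]
    linear_combination hrootC + (z - θ) * hz2
  set L : ℚ[X] := C (a 1) + C (b 1) * X + C (c 1) * X ^ 2 with hL
  have hlamL : lam = aeval θ L := by simpa [hL] using hcoord 1 le_rfl
  have hnormSq := normSq_conj_unit hirr hθ hz hre him hlam0 hint hintinv hL hlamL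
  have hex : ∀ n : ℕ, ∃ e f : ℤ, 1 ≤ n → ∃ g : ℤ, k n = g ∧
      (d : ℝ) * lam ^ n = e + f * θ + k n * θ ^ 2 ∧
      (d : ℂ) * aeval z L ^ n = e + f * z + g * z ^ 2 := by
    intro n
    by_cases hn : 1 ≤ n
    · obtain ⟨e, f, g, h⟩ := hd (lam ^ n) (hint.pow n) ⟨a n, b n, c n, hcoord n hn⟩
      have hg : (g : ℚ) - d * c n = 0 :=
        quadratic_coeff_eq_zero_of_irreducible_cubic hirr (depressed_cubic_natDegree p q) hθ
          (α := e - d * a n) (β := f - d * b n) (by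
            push_cast
            linear_combination d * hcoord n hn - h)
      have hkg : k n = g := by
        have : (g : ℝ) - d * c n = 0 := by exact_mod_cast hg
        rw [hk]; linarith
      refine ⟨e, f, fun _ => ⟨g, hkg, by rw [hkg]; exact h, ?_⟩⟩
      have hP : aeval θ (C (d : ℚ) * L ^ n
          - (C (e : ℚ) + C (f : ℚ) * X + C (g : ℚ) * X ^ 2)) = 0 := by
        rw [map_sub, map_mul, map_pow, ← hlamL]
        simpa [sub_eq_zero] using h
      have := aeval_eq_zero_of_irreducible_root hirr hθ hz hP
      rw [map_sub, map_mul, map_pow] at this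
      simpa [sub_eq_zero] using this
    · exact ⟨0, 0, fun h => absurd h hn⟩
  choose e f hef using hex
  set x : ℕ → ℝ := fun n => k n * θ - f n with hx
  set y : ℕ → ℝ := fun n => k n * θ ^ 2 - e n - k n * p with hy
  have hform : ∀ᶠ n in atTop, (θ * x n - 2 * y n) ^ 2 + (3 * θ ^ 2 - 4 * (p : ℝ)) * x n ^ 2
      = 4 * d ^ 2 * lam⁻¹ ^ n := by
    filter_upwards [eventually_ge_atTop 1] with n hn
    obtain ⟨g, hg, -, h⟩ := hef n hn
    have h' := congrArg Complex.normSq h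
    have hcast : ((e n : ℂ) + f n * z + g * z ^ 2)
        = ((e n : ℝ) : ℂ) + ((f n : ℝ) : ℂ) * z + ((g : ℝ) : ℂ) * z ^ 2 := by push_cast; rfl
    rw [hcast, normSq_quadratic_conj hre him, map_mul, map_pow, hnormSq,
      Complex.normSq_natCast] at h'
    simp only [hx, hy, hg]
    linear_combination -4 * h'
  have hpow : Tendsto (fun n : ℕ => lam⁻¹ ^ n) atTop (nhds 0) :=
    tendsto_pow_atTop_nhds_zero_of_lt_one (by positivity) (inv_lt_one_of_one_lt₀ hlam)
  obtain ⟨hx0, hy0⟩ := tendsto_zero_of_form hΔ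
    (by simpa using hpow.const_mul (4 * (d : ℝ) ^ 2)) hform
  have hkeq : ∀ᶠ n in atTop, k n = (d * lam ^ n + y n + θ * x n) / (3 * θ ^ 2 - p) := by
    filter_upwards [eventually_ge_atTop 1] with n hn
    obtain ⟨-, -, h, -⟩ := hef n hn
    rw [eq_div_iff hD.ne', h]
    simp only [hx, hy]
    ring
  have hr0 : Tendsto (fun n => y n + θ * x n) atTop (nhds 0) := by
    simpa using hy0.add (hx0.const_mul θ)
  have hkpos : ∀ᶠ n in atTop, 0 < k n := by
    filter_upwards [hkeq, hr0.eventually_const_lt (neg_lt_zero.2 hd')] with n hn hr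
    rw [hn]
    refine div_pos ?_ hD
    nlinarith [one_le_pow₀ hlam.le (n := n)]
  refine ⟨hkpos, ?_⟩
  have hlim : Tendsto (fun n => 4 * (d : ℝ) ^ 2 / (3 * θ ^ 2 - p)
      * (d + (y n + θ * x n) * lam⁻¹ ^ n)) atTop (nhds (4 * (d : ℝ) ^ 3 / (3 * θ ^ 2 - p))) := by
    have := ((hr0.mul hpow).const_add (d : ℝ)).const_mul (4 * (d : ℝ) ^ 2 / (3 * θ ^ 2 - p))
    convert this using 2
    ring
  refine hlim.congr' ?_
  have habs : ∀ w : ℕ → ℝ, Tendsto w atTop (nhds 0) → ∀ᶠ n in atTop, |w n| < 1 / 2 :=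
    fun w hw => hw.abs.eventually_lt_const (by norm_num)
  filter_upwards [hkeq, hkpos, hform, habs x hx0, habs y hy0, eventually_ge_atTop 1]
    with n hkn hkn0 hfn hxn hyn hn
  obtain ⟨g, hg, -, -⟩ := hef n hn
  have hun : u n = √(k n) * x n := by
    rw [hu, show k n * θ = x n + (f n : ℤ) by simp only [hx]; ring,
      signedDistNearestInt_add_intCast hxn]
  have hvn : v n = √(k n) * y n := by
    rw [hv, show k n * θ ^ 2 = y n + ((e n + g * p : ℤ) : ℝ) by
      simp only [hy]; push_cast; rw [hg]; ring, signedDistNearestInt_add_intCast hyn]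
  have hs : √(k n) ^ 2 = k n := Real.sq_sqrt hkn0.le
  have hinv : lam ^ n * lam⁻¹ ^ n = 1 := by
    rw [← mul_pow, mul_inv_cancel₀ hlam0.ne', one_pow]
  calc _ = (d * lam ^ n + y n + θ * x n) / (3 * θ ^ 2 - p) * (4 * d ^ 2 * lam⁻¹ ^ n) := by
        rw [div_mul_eq_mul_div, div_mul_eq_mul_div]
        congr 1
        linear_combination -4 * (d : ℝ) ^ 3 * hinv
    _ = _ := by
        rw [← hkn, ← hfn, hun, hvn]
        linear_combination -((θ * x n - 2 * y n) ^ 2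
          + (3 * θ ^ 2 - 4 * (p : ℝ)) * x n ^ 2) * hs
end
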